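/- arXiv:1610.07335 — 2 statements merged into one kernel-verified Lean document; each statement's English description precedes it below -/
import Mathlib

section
/- Fix an integer k ≥ 2 and let H_k : (ℂ²,0) → (ℂ³,0) be H_k(x,y) = (x, y³, y^{3k−1}+xy). Each of the following five polynomial vector fields on ℂ³ (in coordinates (V₁,W₁,W₂)) is liftable over H_k: ζ₁ = ((3k−2)V₁, 3W₁, (3k−1)W₂); ζ₂ = (V₁²+(3k−1)W₁^{k−1}W₂, −3V₁W₁, (3k−1)W₁^{2k−1}); ζ₃ = (W₂²−V₁W₁^{k}, 0, V₁²W₁+W₁^{k}W₂); ζ₄ = ((3k−1)W₁^{2k−1}+V₁W₂, −3W₁W₂, −(3k−1)V₁W₁^{k}); ζ₅ = (−(3k−1)W₁^{2k−2}W₂−V₁²W₁^{k−1}, 3W₂², 3kV₁W₁^{k−1}W₂+V₁³). -/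
open Filter Topology

/-- A vector-field germ `η` on `(ℂᵖ,0)` is liftable over the map-germ
`f : (ℂⁿ,0) → (ℂᵖ,0)` if there is a holomorphic germ `ξ` on `(ℂⁿ,0)` with
`df(x)(ξ(x)) = η(f(x))` near `0`. -/
def Liftable {n p : ℕ} (f : (Fin n → ℂ) → (Fin p → ℂ))
    (η : (Fin p → ℂ) → (Fin p → ℂ)) : Prop :=
  ∃ ξ : (Fin n → ℂ) → (Fin n → ℂ), AnalyticAt ℂ ξ 0 ∧
    ∀ᶠ x in 𝓝 (0 : Fin n → ℂ), fderiv ℂ f x (ξ x) = η (f x)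

/-- The derivative of a map into a three-dimensional space, from those of its components. -/
theorem HasFDerivAt.vecCons_three {𝕜 E : Type*} [NontriviallyNormedField 𝕜]
    [NormedAddCommGroup E] [NormedSpace 𝕜 E] {f g h : E → 𝕜} {f' g' h' : E →L[𝕜] 𝕜} {x : E}
    (hf : HasFDerivAt f f' x) (hg : HasFDerivAt g g' x) (hh : HasFDerivAt h h' x) :
    HasFDerivAt (fun x => ![f x, g x, h x])
      (ContinuousLinearMap.pi (![f', g', h'] : Fin 3 → (E →L[𝕜] 𝕜))) x := by
  rw [hasFDerivAt_pi']
  intro i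
  fin_cases i
  · exact hf
  · exact hg
  · exact hh

/-- The derivative of `(x, y) ↦ (x, y³, yⁿ⁺¹ + xy)` applied to a vector. -/
theorem fderiv_pow_three_pow_succ_add_mul (n : ℕ) (v w : Fin 2 → ℂ) :
    fderiv ℂ (fun v : Fin 2 → ℂ => ![v 0, (v 1) ^ 3, (v 1) ^ (n + 1) + v 0 * v 1]) v w =
      ![w 0, 3 * (v 1) ^ 2 * w 1,
        (((n + 1 : ℕ) : ℂ) * (v 1) ^ n + v 0) * w 1 + v 1 * w 0] := by
  have h0 : HasFDerivAt (fun v : Fin 2 → ℂ => v 0)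
      (ContinuousLinearMap.proj (R := ℂ) (φ := fun _ : Fin 2 => ℂ) 0) v :=
    hasFDerivAt_apply 0 v
  have h1 : HasFDerivAt (fun v : Fin 2 → ℂ => v 1)
      (ContinuousLinearMap.proj (R := ℂ) (φ := fun _ : Fin 2 => ℂ) 1) v :=
    hasFDerivAt_apply 1 v
  have h2 : HasFDerivAt (fun v : Fin 2 → ℂ => (v 1) ^ (n + 1) + v 0 * v 1) _ v :=
    (h1.pow (n + 1)).add (h0.mul h1)
  rw [(h0.vecCons_three (h1.pow 3) h2).fderiv]
  ext i
  fin_cases i <;> simp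
  ring

/-- A vector field is liftable over `(x, y) ↦ (x, y³, yⁿ⁺¹ + xy)` as soon as the lifting equations
hold for the components `a`, `b` of an analytic vector field on the source. -/
theorem liftable_of_components (n : ℕ) (η : (Fin 3 → ℂ) → (Fin 3 → ℂ)) (a b : (Fin 2 → ℂ) → ℂ)
    (ha : AnalyticAt ℂ a 0) (hb : AnalyticAt ℂ b 0)
    (h : ∀ v : Fin 2 → ℂ, ![a v, 3 * (v 1) ^ 2 * b v,
        (((n + 1 : ℕ) : ℂ) * (v 1) ^ n + v 0) * b v + v 1 * a v] =
      η ![v 0, (v 1) ^ 3, (v 1) ^ (n + 1) + v 0 * v 1]) :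
    Liftable (fun v : Fin 2 → ℂ => ![v 0, (v 1) ^ 3, (v 1) ^ (n + 1) + v 0 * v 1]) η := by
  refine ⟨fun v => ![a v, b v], ?_, Eventually.of_forall fun v => ?_⟩
  · rw [analyticAt_pi_iff]
    intro i
    fin_cases i
    · exact ha
    · exact hb
  · rw [fderiv_pow_three_pow_succ_add_mul, ← h v]
    simp

/-- Coordinate functions are analytic. -/
@[fun_prop]
theorem analyticAt_coord {ι : Type*} [Fintype ι] (i : ι) (v : ι → ℂ) :
    AnalyticAt ℂ (fun v : ι → ℂ => v i) v :=
  (ContinuousLinearMap.proj (R := ℂ) (φ := fun _ : ι => ℂ) i).analyticAt v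

/-- for `k ≥ 2`, the five listed polynomial vector fields on `ℂ³`
(in coordinates `(V₁,W₁,W₂)`) are liftable over `H_k(x,y) = (x, y³, y^{3k−1}+xy)`. -/
theorem liftable_fields_of_Hk
    (k : ℕ) (hk : 2 ≤ k)
    (H : (Fin 2 → ℂ) → (Fin 3 → ℂ))
    (hH : ∀ v : Fin 2 → ℂ, H v = ![v 0, (v 1) ^ 3, (v 1) ^ (3 * k - 1) + v 0 * v 1]) :
    Liftable H (fun V => ![((3 * k - 2 : ℕ) : ℂ) * V 0, 3 * V 1,
      ((3 * k - 1 : ℕ) : ℂ) * V 2]) ∧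
    Liftable H (fun V => ![(V 0) ^ 2 + ((3 * k - 1 : ℕ) : ℂ) * (V 1) ^ (k - 1) * V 2,
      -3 * V 0 * V 1, ((3 * k - 1 : ℕ) : ℂ) * (V 1) ^ (2 * k - 1)]) ∧
    Liftable H (fun V => ![(V 2) ^ 2 - V 0 * (V 1) ^ k, 0,
      (V 0) ^ 2 * V 1 + (V 1) ^ k * V 2]) ∧
    Liftable H (fun V => ![((3 * k - 1 : ℕ) : ℂ) * (V 1) ^ (2 * k - 1) + V 0 * V 2,
      -3 * V 1 * V 2, -(((3 * k - 1 : ℕ) : ℂ)) * V 0 * (V 1) ^ k]) ∧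
    Liftable H (fun V => ![-(((3 * k - 1 : ℕ) : ℂ)) * (V 1) ^ (2 * k - 2) * V 2
        - (V 0) ^ 2 * (V 1) ^ (k - 1),
      3 * (V 2) ^ 2, ((3 * k : ℕ) : ℂ) * V 0 * (V 1) ^ (k - 1) * V 2 + (V 0) ^ 3]) := by
  obtain ⟨m, rfl⟩ : ∃ m, k = m + 1 := ⟨k - 1, by omega⟩
  obtain rfl : H = _ := funext hH
  rw [show 3 * (m + 1) - 1 = 3 * m + 1 + 1 by omega, show 3 * (m + 1) - 2 = 3 * m + 1 by omega,
    show 2 * (m + 1) - 1 = 2 * m + 1 by omega, show 2 * (m + 1) - 2 = 2 * m by omega,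
    show m + 1 - 1 = m by omega]
  refine ⟨?_, ?_, ?_, ?_, ?_⟩
  · refine liftable_of_components _ _
      (fun v => (3 * m + 1) * v 0) (fun v => v 1)
      (by fun_prop) (by fun_prop) fun v => ?_
    ext i
    fin_cases i <;> simp [-mul_eq_mul_left_iff, -sub_right_inj, -add_right_inj] <;> ring
  · refine liftable_of_components _ _
      (fun v => (v 0) ^ 2 +
        (3 * m + 2) * (v 1) ^ (3 * m) * ((v 1) ^ (3 * m + 2) + v 0 * v 1))
      (fun v => -(v 0 * v 1))
      (by fun_prop) (by fun_prop) fun v => ?_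
    ext i
    fin_cases i <;> simp [-mul_eq_mul_left_iff, -sub_right_inj, -add_right_inj] <;> ring
  · refine liftable_of_components _ _
      (fun v => ((v 1) ^ (3 * m + 2) + v 0 * v 1) ^ 2 - v 0 * (v 1) ^ (3 * m + 3)) (fun _ => 0)
      (by fun_prop) (by fun_prop) fun v => ?_
    ext i
    fin_cases i <;> simp [-mul_eq_mul_left_iff, -sub_right_inj, -add_right_inj] <;> ring
  · refine liftable_of_components _ _
      (fun v => (3 * m + 2) * (v 1) ^ (6 * m + 3) + v 0 * ((v 1) ^ (3 * m + 2) + v 0 * v 1))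
      (fun v => -(v 1 * ((v 1) ^ (3 * m + 2) + v 0 * v 1)))
      (by fun_prop) (by fun_prop) fun v => ?_
    ext i
    fin_cases i <;> simp [-mul_eq_mul_left_iff, -sub_right_inj, -add_right_inj] <;> ring
  · refine liftable_of_components _ _
      (fun v => -((3 * m + 2) * (v 1) ^ (6 * m) * ((v 1) ^ (3 * m + 2) + v 0 * v 1))
        - (v 0) ^ 2 * (v 1) ^ (3 * m))
      (fun v => ((v 1) ^ (3 * m + 1) + v 0) ^ 2)
      (by fun_prop) (by fun_prop) fun v => ?_
    ext i
    fin_cases i <;> simp [-mul_eq_mul_left_iff, -sub_right_inj, -add_right_inj] <;> ring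
end

section
/- Fix an integer k ≥ 2 and let H_k : (ℂ²,0) → (ℂ³,0) be H_k(x,y) = (x, y³, y^{3k−1}+xy). If η : (ℂ³,0) → ℂ³ is a holomorphic vector-field germ liftable over H_k, then there exist holomorphic function germs α₁,…,α₅ : (ℂ³,0) → ℂ such that η = α₁ζ₁ + α₂ζ₂ + α₃ζ₃ + α₄ζ₄ + α₅ζ₅ on a neighbourhood of 0, where (in coordinates (V₁,W₁,W₂)) ζ₁ = ((3k−2)V₁, 3W₁, (3k−1)W₂), ζ₂ = (V₁²+(3k−1)W₁^{k−1}W₂, −3V₁W₁, (3k−1)W₁^{2k−1}), ζ₃ = (W₂²−V₁W₁^{k}, 0, V₁²W₁+W₁^{k}W₂), ζ₄ = ((3k−1)W₁^{2k−1}+V₁W₂, −3W₁W₂, −(3k−1)V₁W₁^{k}), ζ₅ = (−(3k−1)W₁^{2k−2}W₂−V₁²W₁^{k−1}, 3W₂², 3kV₁W₁^{k−1}W₂+V₁³). That is, these five vector fields generate the module of vector fields liftable over H_k. -/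
open Filter Topology

/-- The five generators ζ₁,…,ζ₅ of `Lift(H_k)`, in coordinates `(V₁,W₁,W₂)`. -/
def zeta (k : ℕ) : Fin 5 → (Fin 3 → ℂ) → (Fin 3 → ℂ) :=
  ![fun V => ![((3 * k - 2 : ℕ) : ℂ) * V 0, 3 * V 1, ((3 * k - 1 : ℕ) : ℂ) * V 2],
    fun V => ![(V 0) ^ 2 + ((3 * k - 1 : ℕ) : ℂ) * (V 1) ^ (k - 1) * V 2,
      -3 * V 0 * V 1, ((3 * k - 1 : ℕ) : ℂ) * (V 1) ^ (2 * k - 1)],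
    fun V => ![(V 2) ^ 2 - V 0 * (V 1) ^ k, 0, (V 0) ^ 2 * V 1 + (V 1) ^ k * V 2],
    fun V => ![((3 * k - 1 : ℕ) : ℂ) * (V 1) ^ (2 * k - 1) + V 0 * V 2,
      -3 * V 1 * V 2, -(((3 * k - 1 : ℕ) : ℂ)) * V 0 * (V 1) ^ k],
    fun V => ![-(((3 * k - 1 : ℕ) : ℂ)) * (V 1) ^ (2 * k - 2) * V 2
        - (V 0) ^ 2 * (V 1) ^ (k - 1),
      3 * (V 2) ^ 2, ((3 * k : ℕ) : ℂ) * V 0 * (V 1) ^ (k - 1) * V 2 + (V 0) ^ 3]]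

section AbsolutelyConvergentSeries

/-- The continuous linear extension to `ℓ¹(α)` of a map from the canonical basis to the unit ball
of a Banach space. -/
noncomputable def l1Lift {α F : Type*} [NormedAddCommGroup F] [NormedSpace ℂ F] [CompleteSpace F]
    (u : α → F) (hu : ∀ a, ‖u a‖ ≤ 1) : lp (fun _ : α => ℂ) 1 →L[ℂ] F :=
  have hs : ∀ c : lp (fun _ : α => ℂ) 1, Summable fun a => ‖c a‖ := fun c => by
    simpa using (lp.memℓp c).summable (by simp)
  have hb : ∀ (c : lp (fun _ : α => ℂ) 1) a, ‖c a • u a‖ ≤ ‖c a‖ := fun c a => by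
    rw [norm_smul]; exact mul_le_of_le_one_right (norm_nonneg _) (hu a)
  have hsu : ∀ c : lp (fun _ : α => ℂ) 1, Summable fun a => c a • u a := fun c =>
    .of_norm_bounded (hs c) (hb c)
  LinearMap.mkContinuous
    { toFun := fun c => ∑' a, c a • u a
      map_add' := fun c d => by
        rw [← (hsu c).tsum_add (hsu d)]
        simp [add_smul]
      map_smul' := fun z c => by
        rw [RingHom.id_apply, ← (hsu c).tsum_const_smul z]
        simp [mul_smul] } 1 fun c => by
      rw [one_mul, lp.norm_eq_tsum_rpow (by simp) c]
      simpa using tsum_of_norm_bounded (hs c).hasSum (hb c)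

section

variable {α F : Type*} [NormedAddCommGroup F] [NormedSpace ℂ F]

theorem l1_ext [DecidableEq α] {f g : lp (fun _ : α => ℂ) 1 →L[ℂ] F}
    (h : ∀ a, f (lp.single 1 a 1) = g (lp.single 1 a 1)) : f = g := by
  refine lp.ext_continuousLinearMap (by simp) fun a => ?_
  ext
  simpa using h a

variable [CompleteSpace F]

theorem l1Lift_apply (u : α → F) (hu : ∀ a, ‖u a‖ ≤ 1) (c : lp (fun _ : α => ℂ) 1) :
    l1Lift u hu c = ∑' a, c a • u a := rfl

theorem l1Lift_single [DecidableEq α] (u : α → F) (hu : ∀ a, ‖u a‖ ≤ 1) (a : α) (z : ℂ) :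
    l1Lift u hu (lp.single 1 a z) = z • u a := by
  rw [l1Lift_apply, tsum_eq_single a]
  · simp
  · intro b hb
    simp [hb]

theorem norm_l1Lift_le (u : α → F) (hu : ∀ a, ‖u a‖ ≤ 1) : ‖l1Lift u hu‖ ≤ 1 := by
  unfold l1Lift
  exact LinearMap.mkContinuous_norm_le _ zero_le_one _

end

variable {ι : Type*}

/-- The product of the coordinates prescribed by a word, as a multilinear map. -/
noncomputable def wordMultilinear {n : ℕ} (s : Fin n → ι) :
    ContinuousMultilinearMap ℂ (fun _ : Fin n => ι → ℂ) ℂ :=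
  (ContinuousMultilinearMap.mkPiAlgebra ℂ (Fin n) ℂ).compContinuousLinearMap
    fun j => ContinuousLinearMap.proj (s j)

theorem wordMultilinear_apply {n : ℕ} (s : Fin n → ι) (v : Fin n → ι → ℂ) :
    wordMultilinear s v = ∏ j, v j (s j) := by
  simp [wordMultilinear]

variable [Fintype ι]

/-- The value at `v` of the monomial with multi-exponent `m`. -/
def monomialValue (v : ι → ℂ) (m : ι → ℕ) : ℂ := ∏ i, v i ^ m i

theorem norm_monomialValue_le_one {v : ι → ℂ} (hv : ‖v‖ ≤ 1) (m : ι → ℕ) :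
    ‖monomialValue v m‖ ≤ 1 := by
  rw [monomialValue, norm_prod]
  refine Finset.prod_le_one (fun _ _ => norm_nonneg _) fun i _ => ?_
  rw [norm_pow]
  exact pow_le_one₀ (norm_nonneg _) ((norm_le_pi_norm v i).trans hv)

theorem monomialValue_add (v : ι → ℂ) (m m' : ι → ℕ) :
    monomialValue v (m + m') = monomialValue v m * monomialValue v m' := by
  simp [monomialValue, pow_add, Finset.prod_mul_distrib]

theorem monomialValue_smul (r : ℂ) (v : ι → ℂ) (m : ι → ℕ) :
    monomialValue (r • v) m = r ^ (∑ i, m i) * monomialValue v m := by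
  simp [monomialValue, mul_pow, Finset.prod_mul_distrib, Finset.prod_pow_eq_pow_sum]

theorem monomialValue_single [DecidableEq ι] (v : ι → ℂ) (i : ι) (d : ℕ) :
    monomialValue v (Pi.single i d) = v i ^ d := by
  rw [monomialValue, Finset.prod_eq_single i] <;> simp +contextual

/-- The sum at `v` of the power series with coefficients `c`. -/
noncomputable def seriesSum (c : lp (fun _ : ι → ℕ => ℂ) 1) (v : ι → ℂ) : ℂ :=
  ∑' m, c m * monomialValue v m

theorem seriesSum_eq_l1Lift (c : lp (fun _ : ι → ℕ => ℂ) 1) {v : ι → ℂ} (hv : ‖v‖ ≤ 1) :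
    seriesSum c v = l1Lift (monomialValue v) (norm_monomialValue_le_one hv) c := rfl

theorem exists_word_of_sum_eq {n : ℕ} {m : ι → ℕ} (h : ∑ i, m i = n) :
    ∃ s : Fin n → ι, ∀ v : ι → ℂ, ∏ j, v (s j) = monomialValue v m := by
  have hc : Fintype.card (Σ i, Fin (m i)) = n := by simp [h]
  let e := Fintype.equivFinOfCardEq hc
  refine ⟨fun j => (e.symm j).1, fun v => ?_⟩
  rw [e.symm.prod_comp (fun x => v x.1), Fintype.prod_sigma]
  simp [monomialValue]

theorem norm_wordMultilinear_le {n : ℕ} (s : Fin n → ι) : ‖wordMultilinear s‖ ≤ 1 := by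
  refine ContinuousMultilinearMap.opNorm_le_bound zero_le_one fun v => ?_
  rw [wordMultilinear_apply, norm_prod, one_mul]
  exact Finset.prod_le_prod (fun _ _ => norm_nonneg _) fun j _ => norm_le_pi_norm (v j) (s j)

theorem summable_norm_l1 {α : Type*} (c : lp (fun _ : α => ℂ) 1) : Summable fun a => ‖c a‖ := by
  simpa using (lp.memℓp c).summable (by simp)

theorem analyticAt_seriesSum (c : lp (fun _ : ι → ℕ => ℂ) 1) :
    AnalyticAt ℂ (seriesSum c) 0 := by
  choose s hs using fun (n : ℕ) (m : {m : ι → ℕ // ∑ i, m i = n}) => exists_word_of_sum_eq m.2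
  have hc := summable_norm_l1 c
  have hb : ∀ (n : ℕ) (m : {m : ι → ℕ // ∑ i, m i = n}),
      ‖c m • wordMultilinear (s n m)‖ ≤ ‖c m‖ := fun n m => by
    rw [norm_smul]
    exact mul_le_of_le_one_right (norm_nonneg _) (norm_wordMultilinear_le _)
  have hcn : ∀ n : ℕ, Summable fun m : {m : ι → ℕ // ∑ i, m i = n} => ‖c m‖ :=
    fun n => hc.subtype _
  have hsum : ∀ n : ℕ, Summable fun m : {m : ι → ℕ // ∑ i, m i = n} =>
      c m • wordMultilinear (s n m) := fun n => .of_norm_bounded (hcn n) (hb n)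
  let p : FormalMultilinearSeries ℂ (ι → ℂ) ℂ :=
    fun n => ∑' m : {m : ι → ℕ // ∑ i, m i = n}, c m • wordMultilinear (s n m)
  have hp : HasFPowerSeriesOnBall (seriesSum c) p 0 1 := by
    refine ⟨?_, one_pos, fun {y} hy => ?_⟩
    · rw [← ENNReal.coe_one]
      refine p.le_radius_of_bound (∑' m, ‖c m‖) fun n => ?_
      rw [NNReal.coe_one, one_pow, mul_one]
      exact (tsum_of_norm_bounded (hcn n).hasSum (hb n)).trans
        (hc.tsum_subtype_le _ _ fun _ => norm_nonneg _)
    · have hy1 : ‖y‖ ≤ 1 := by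
        have : ‖y‖ₑ < 1 := by simpa using hy
        rw [← ofReal_norm, ENNReal.ofReal_lt_one] at this
        exact this.le
      have hcy : Summable fun m => c m * monomialValue y m :=
        .of_norm_bounded hc fun m => by
          rw [norm_mul]
          exact mul_le_of_le_one_right (norm_nonneg _) (norm_monomialValue_le_one hy1 m)
      rw [zero_add]
      refine ((Equiv.sigmaFiberEquiv fun m : ι → ℕ => ∑ i, m i).hasSum_iff.2 hcy.hasSum).sigma
        fun n => ?_
      have h := (hsum n).hasSum.mapL (ContinuousMultilinearMap.apply ℂ (fun _ : Fin n => ι → ℂ) ℂ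
        fun _ => y)
      simpa [wordMultilinear_apply, hs, Function.comp_def] using h
  exact hp.analyticAt

theorem exists_seriesSum_eq [DecidableEq ι] {f : (ι → ℂ) → ℂ} (hf : AnalyticAt ℂ f 0) :
    ∃ r₀ > 0, ∀ r : ℝ, 0 < r → r < r₀ → ∃ c : lp (fun _ : ι → ℕ => ℂ) 1,
      ∀ v, ‖v‖ ≤ 1 → f ((r : ℂ) • v) = seriesSum c v := by
  obtain ⟨p, R, hp⟩ := hf
  obtain ⟨R', hR'0, hR'R⟩ := ENNReal.lt_iff_exists_nnreal_btwn.1 hp.r_pos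
  have hR'0 : 0 < R' := by exact_mod_cast hR'0
  refine ⟨R' / (Fintype.card ι + 1), by positivity, fun r hr hr₀ => ?_⟩
  have hr₁ : r * (Fintype.card ι + 1) < R' := (lt_div_iff₀ (by positivity)).1 hr₀
  let e : ι → ι → ℂ := fun i => Pi.single i 1
  let d : (Σ n, Fin n → ι) → ℂ := fun w => (r : ℂ) ^ w.1 * p w.1 fun j => e (w.2 j)
  let count : (Σ n, Fin n → ι) → ι → ℕ := fun w i => Finset.card {j | w.2 j = i}
  have hcount : ∀ (w : Σ n, Fin n → ι) (v : ι → ℂ),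
      monomialValue v (count w) = ∏ j, v (w.2 j) := fun w v => by
    rw [← Finset.prod_fiberwise' Finset.univ w.2 v]
    simp [monomialValue, count]
  have hp_norm : ∀ w : Σ n, Fin n → ι, ‖p w.1 fun j => e (w.2 j)‖ ≤ ‖p w.1‖ := fun w => by
    refine ((p w.1).le_opNorm _).trans_eq ?_
    simp [e, Pi.norm_single]
  have hd : Summable fun w => ‖d w‖ := by
    rw [summable_sigma_of_nonneg fun _ => norm_nonneg _]
    refine ⟨fun n => Summable.of_finite, ?_⟩
    refine .of_nonneg_of_le (fun n => tsum_nonneg fun _ => norm_nonneg _) (fun n => ?_)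
      (p.summable_norm_mul_pow (hR'R.trans_le hp.r_le))
    rw [tsum_fintype]
    calc ∑ s : Fin n → ι, ‖d ⟨n, s⟩‖ ≤ ∑ _s : Fin n → ι, r ^ n * ‖p n‖ := by
          refine Finset.sum_le_sum fun s _ => ?_
          simp only [d, norm_mul, norm_pow, Complex.norm_real, Real.norm_of_nonneg hr.le]
          gcongr
          exact hp_norm ⟨n, s⟩
      _ = ‖p n‖ * (r * Fintype.card ι) ^ n := by
          simp; ring
      _ ≤ ‖p n‖ * (R' : ℝ) ^ n := by
          gcongr
          nlinarith
  have hsingle : Summable fun w => lp.single (E := fun _ : ι → ℕ => ℂ) 1 (count w) (d w) :=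
    .of_norm (by simpa [lp.norm_single] using hd)
  refine ⟨∑' w, lp.single 1 (count w) (d w), fun v hv => ?_⟩
  have hsum := hsingle.hasSum.mapL (l1Lift (monomialValue v) (norm_monomialValue_le_one hv))
  simp only [l1Lift_single, hcount] at hsum
  rw [← seriesSum_eq_l1Lift _ hv] at hsum
  have hfib := hsum.sigma fun n => hasSum_fintype _
  have hrv : (r : ℂ) • v ∈ Metric.eball (0 : ι → ℂ) R := by
    have h1 : ‖(r : ℂ) • v‖₊ < R' := by
      rw [← NNReal.coe_lt_coe, coe_nnnorm, norm_smul, Complex.norm_real, Real.norm_of_nonneg hr.le]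
      nlinarith [norm_nonneg v, Nat.cast_nonneg (α := ℝ) (Fintype.card ι)]
    rw [mem_eball_zero_iff]
    exact lt_trans (by exact_mod_cast h1) hR'R
  have hfs := hp.hasSum hrv
  rw [zero_add] at hfs
  refine hfs.unique ?_
  convert hfib using 2 with n
  have hv_sum : (r : ℂ) • v = ∑ i, ((r : ℂ) * v i) • e i := by
    ext i
    simp [e, Finset.sum_apply, Pi.single_apply]
  rw [hv_sum, (p n).map_sum]
  refine Finset.sum_congr rfl fun s _ => ?_
  rw [(p n).map_smul_univ]
  simp [d, Finset.prod_mul_distrib]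
  ring

/-- Multiplication of power series by the monomial with exponent `a`. -/
noncomputable def monomialShift [DecidableEq ι] (a : ι → ℕ) :
    lp (fun _ : ι → ℕ => ℂ) 1 →L[ℂ] lp (fun _ : ι → ℕ => ℂ) 1 :=
  l1Lift (fun m => lp.single 1 (m + a) 1) fun m => by simp [lp.norm_single]

/-- The quotient of a power series by the `i`-th variable, discarding the remainder. -/
noncomputable def variableQuotient [DecidableEq ι] (i : ι) :
    lp (fun _ : ι → ℕ => ℂ) 1 →L[ℂ] lp (fun _ : ι → ℕ => ℂ) 1 :=
  l1Lift (fun m => if m i = 0 then 0 else lp.single 1 (m - Pi.single i 1) 1) fun m => by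
    split_ifs <;> simp [lp.norm_single]

variable [DecidableEq ι]

theorem seriesSum_monomialShift (a : ι → ℕ) (c : lp (fun _ : ι → ℕ => ℂ) 1) {v : ι → ℂ}
    (hv : ‖v‖ ≤ 1) : seriesSum (monomialShift a c) v = monomialValue v a * seriesSum c v := by
  rw [seriesSum_eq_l1Lift _ hv, seriesSum_eq_l1Lift _ hv]
  set L := l1Lift (monomialValue v) (norm_monomialValue_le_one hv) with hL
  change (L.comp (monomialShift a)) c = (monomialValue v a • L) c
  congr 1
  refine l1_ext fun m => ?_
  simp [hL, monomialShift, l1Lift_single, monomialValue_add, mul_comm]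

theorem norm_update_zero_le (v : ι → ℂ) (i : ι) : ‖Function.update v i 0‖ ≤ ‖v‖ := by
  refine (pi_norm_le_iff_of_nonneg (norm_nonneg _)).2 fun j => ?_
  rcases eq_or_ne j i with rfl | h
  · simp
  · simpa [h] using norm_le_pi_norm v j

theorem monomialValue_update_zero (v : ι → ℂ) (i : ι) (m : ι → ℕ) :
    monomialValue (Function.update v i 0) m = if m i = 0 then monomialValue v m else 0 := by
  split_ifs with h
  · refine Finset.prod_congr rfl fun j _ => ?_
    rcases eq_or_ne j i with rfl | hj
    · simp [h]
    · simp [hj]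
  · exact Finset.prod_eq_zero (Finset.mem_univ i) (by simp [h])

theorem seriesSum_eq_update_add (i : ι) (c : lp (fun _ : ι → ℕ => ℂ) 1) {v : ι → ℂ}
    (hv : ‖v‖ ≤ 1) :
    seriesSum c v =
      seriesSum c (Function.update v i 0) + v i * seriesSum (variableQuotient i c) v := by
  have hv' := (norm_update_zero_le v i).trans hv
  rw [seriesSum_eq_l1Lift _ hv, seriesSum_eq_l1Lift _ hv, seriesSum_eq_l1Lift _ hv']
  set L := l1Lift (monomialValue v) (norm_monomialValue_le_one hv) with hL
  set L' := l1Lift _ (norm_monomialValue_le_one hv') with hL'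
  change L c = (L' + v i • L.comp (variableQuotient i)) c
  congr 1
  refine l1_ext fun m => ?_
  simp only [hL, hL', variableQuotient, l1Lift_single, add_apply, smul_apply,
    ContinuousLinearMap.comp_apply, one_smul, monomialValue_update_zero]
  split_ifs with h
  · simp
  · have hm : m - Pi.single i 1 + Pi.single i 1 = m := by
      refine tsub_add_cancel_of_le fun j => ?_
      rcases eq_or_ne j i with rfl | hj
      · simpa using Nat.one_le_iff_ne_zero.2 h
      · simp [hj]
    conv_lhs => rw [← hm]
    rw [monomialValue_add, monomialValue_single, l1Lift_single]
    simp [mul_comm]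

theorem seriesSum_eq_sum_update_add (i : ι) (d : ℕ) (c : lp (fun _ : ι → ℕ => ℂ) 1) {v : ι → ℂ}
    (hv : ‖v‖ ≤ 1) :
    seriesSum c v =
      ∑ l ∈ Finset.range d,
          v i ^ l * seriesSum ((variableQuotient i ^ l) c) (Function.update v i 0) +
        v i ^ d * seriesSum ((variableQuotient i ^ d) c) v := by
  induction d with
  | zero => simp
  | succ d ih =>
    rw [ih, Finset.sum_range_succ, seriesSum_eq_update_add i ((variableQuotient i ^ d) c) hv,
      pow_succ' (variableQuotient i) d, mul_apply_eq_comp]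
    ring

/-- Division of convergent power series by a perturbation of `v i ^ d` by monomials of total
degree greater than `d`. -/
theorem AnalyticAt.exists_division {f : (ι → ℂ) → ℂ} (hf : AnalyticAt ℂ f 0) (i : ι) (d : ℕ)
    {J : Type*} (s : Finset J) (a : J → ℂ) (m : J → ι → ℕ) (hm : ∀ j ∈ s, d < ∑ i, m j i) :
    ∃ (q : (ι → ℂ) → ℂ) (g : ℕ → (ι → ℂ) → ℂ), AnalyticAt ℂ q 0 ∧ (∀ l, AnalyticAt ℂ (g l) 0) ∧
      ∀ᶠ v in 𝓝 0, f v = q v * (v i ^ d - ∑ j ∈ s, a j * monomialValue v (m j)) +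
        ∑ l ∈ Finset.range d, v i ^ l * g l (Function.update v i 0) := by
  obtain ⟨r₀, hr₀, hseries⟩ := exists_seriesSum_eq hf
  set A : ℝ := ∑ j ∈ s, ‖a j‖ with hA
  have hA0 : 0 ≤ A := Finset.sum_nonneg fun _ _ => norm_nonneg _
  obtain ⟨r, hr, hrlt⟩ : ∃ r : ℝ, 0 < r ∧ r < min (min r₀ 1) (1 / (A + 1)) :=
    exists_between (by positivity)
  simp only [lt_min_iff] at hrlt
  obtain ⟨⟨hrr₀, hr1⟩, hrA⟩ := hrlt
  have hrA' : r * A < 1 := by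
    rw [lt_div_iff₀ (by positivity)] at hrA
    linarith
  obtain ⟨c, hc⟩ := hseries r hr hrr₀
  set T := variableQuotient i with hT
  have hTd : ‖T ^ d‖ ≤ 1 := by
    clear hm
    induction d with
    | zero => exact ContinuousLinearMap.norm_id_le
    | succ d ih =>
      rw [pow_succ]
      exact (norm_mul_le _ _).trans (mul_le_one₀ ih (norm_nonneg _) (norm_l1Lift_le _ _))
  let K : lp (fun _ : ι → ℕ => ℂ) 1 →L[ℂ] lp (fun _ : ι → ℕ => ℂ) 1 :=
    ∑ j ∈ s, (a j * (r : ℂ) ^ ((∑ i, m j i) - d)) • (monomialShift (m j) * T ^ d)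
  have hK : ‖K‖ < 1 := by
    refine lt_of_le_of_lt ((norm_sum_le _ _).trans ?_) hrA'
    rw [hA, Finset.mul_sum]
    refine Finset.sum_le_sum fun j hj => ?_
    have h1 : ‖monomialShift (m j) * T ^ d‖ ≤ 1 :=
      (norm_mul_le _ _).trans (mul_le_one₀ (norm_l1Lift_le _ _) (norm_nonneg _) hTd)
    have h2 : r ^ ((∑ i, m j i) - d) ≤ r :=
      pow_le_of_le_one hr.le hr1.le (Nat.sub_ne_zero_of_lt (hm j hj))
    rw [norm_smul, norm_mul, norm_pow, Complex.norm_real, Real.norm_of_nonneg hr.le]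
    calc ‖a j‖ * r ^ ((∑ i, m j i) - d) * ‖monomialShift (m j) * T ^ d‖ ≤ ‖a j‖ * r * 1 := by
          gcongr
      _ = r * ‖a j‖ := by ring
  set g := (Units.oneSub K hK)⁻¹.val c with hg
  have hgc : g = c + K g := by
    have h : (Units.oneSub K hK).val g = c := by
      rw [hg, ← mul_apply_eq_comp, Units.mul_inv, one_apply_eq_self]
    rw [← h]
    simp
  have hr' : (r : ℂ) ≠ 0 := by exact_mod_cast hr.ne'
  have han : ∀ (c : lp (fun _ : ι → ℕ => ℂ) 1) (z : ℂ),
      AnalyticAt ℂ (fun v => z * seriesSum c ((r : ℂ)⁻¹ • v)) 0 := fun c z => by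
    have h := analyticAt_seriesSum c
    refine analyticAt_const.mul (AnalyticAt.comp_of_eq h ?_ (smul_zero _))
    fun_prop
  refine ⟨fun v => ((r : ℂ) ^ d)⁻¹ * seriesSum ((T ^ d) g) ((r : ℂ)⁻¹ • v),
    fun l v => ((r : ℂ) ^ l)⁻¹ * seriesSum ((T ^ l) g) ((r : ℂ)⁻¹ • v), han _ _, fun l => han _ _, ?_⟩
  filter_upwards [Metric.ball_mem_nhds (0 : ι → ℂ) hr] with v hv
  set w := (r : ℂ)⁻¹ • v with hw
  have hvw : v = (r : ℂ) • w := by rw [hw, smul_inv_smul₀ hr']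
  have hw1 : ‖w‖ ≤ 1 := by
    rw [mem_ball_zero_iff] at hv
    rw [hw, norm_smul, norm_inv, Complex.norm_real, Real.norm_of_nonneg hr.le, inv_mul_le_one₀ hr]
    exact hv.le
  have hKg : seriesSum (K g) w = (∑ j ∈ s, a j * (r : ℂ) ^ ((∑ i, m j i) - d) *
      monomialValue w (m j)) * seriesSum ((T ^ d) g) w := by
    rw [seriesSum_eq_l1Lift _ hw1]
    simp only [K, sum_apply, smul_apply, map_sum, map_smul,
      mul_apply_eq_comp]
    simp only [← seriesSum_eq_l1Lift _ hw1, seriesSum_monomialShift _ _ hw1, Finset.sum_mul,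
      smul_eq_mul, mul_assoc]
  have hadd : seriesSum g w = seriesSum c w + seriesSum (K g) w := by
    simp only [seriesSum_eq_l1Lift _ hw1]
    rw [← map_add, ← hgc]
  have hsplit := seriesSum_eq_sum_update_add i d g hw1
  have hfv : f v = seriesSum c w := by rw [hvw, hc w hw1]
  have hupd : (r : ℂ)⁻¹ • Function.update v i 0 = Function.update w i 0 := by
    rw [hw, ← Function.update_smul, smul_zero]
  have hrem : ∀ l, v i ^ l * (((r : ℂ) ^ l)⁻¹ *
      seriesSum ((T ^ l) g) ((r : ℂ)⁻¹ • Function.update v i 0)) =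
      w i ^ l * seriesSum ((T ^ l) g) (Function.update w i 0) := fun l => by
    rw [hupd, hw, Pi.smul_apply, smul_eq_mul, mul_pow, inv_pow]
    ring
  have hdiv : ((r : ℂ) ^ d)⁻¹ * (v i ^ d - ∑ j ∈ s, a j * monomialValue v (m j)) =
      w i ^ d - ∑ j ∈ s, a j * (r : ℂ) ^ ((∑ i, m j i) - d) * monomialValue w (m j) := by
    rw [mul_sub, Finset.mul_sum]
    congr 1
    · rw [hw, Pi.smul_apply, smul_eq_mul, mul_pow, inv_pow]
    · refine Finset.sum_congr rfl fun j hj => ?_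
      rw [hvw, monomialValue_smul, pow_sub₀ _ hr' (hm j hj).le]
      ring
  simp only [hrem]
  rw [hfv, eq_sub_of_add_eq hadd.symm, hKg, hsplit]
  linear_combination (-seriesSum ((T ^ d) g) w) * hdiv

end AbsolutelyConvergentSeries

theorem AnalyticAt.eventually_eq_zero_of_coord_ne {ι : Type*} [Fintype ι] [DecidableEq ι]
    {f : (ι → ℂ) → ℂ} (hf : AnalyticAt ℂ f 0) (i : ι) (h : ∀ᶠ v in 𝓝 0, v i ≠ 0 → f v = 0) :
    ∀ᶠ v in 𝓝 0, f v = 0 := by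
  filter_upwards [hf.eventually_analyticAt, eventually_eventually_nhds.2 h] with v hv hvz
  by_contra hne
  have hvi : v i = 0 := by
    by_contra hvi
    exact hne (hvz.self_of_nhds hvi)
  have hpath : Tendsto (fun t : ℂ => v + t • Pi.single i (1 : ℂ)) (𝓝[≠] 0) (𝓝 v) := by
    refine tendsto_nhdsWithin_of_tendsto_nhds ?_
    have hc : Continuous fun t : ℂ => v + t • (Pi.single i (1 : ℂ) : ι → ℂ) := by fun_prop
    simpa using hc.tendsto 0
  obtain ⟨t, ⟨ht1, ht2⟩, ht⟩ := ((hpath.eventually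
    (hvz.and (hv.continuousAt.eventually_ne hne))).and self_mem_nhdsWithin).exists
  exact ht2 (ht1 (by simpa [hvi] using ht))

theorem AnalyticAt.exists_eq_coord_mul {ι : Type*} [Fintype ι] [DecidableEq ι]
    {f : (ι → ℂ) → ℂ} (hf : AnalyticAt ℂ f 0) (i : ι)
    (h : ∀ᶠ v in 𝓝 0, f (Function.update v i 0) = 0) :
    ∃ q : (ι → ℂ) → ℂ, AnalyticAt ℂ q 0 ∧ ∀ᶠ v in 𝓝 0, f v = v i * q v := by
  obtain ⟨q, g, hq, -, hfq⟩ :=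
    hf.exists_division i 1 (∅ : Finset ℕ) (fun _ => 0) (fun _ _ => 0) (by simp)
  refine ⟨q, hq, ?_⟩
  have hupd : Tendsto (fun v : ι → ℂ => Function.update v i 0) (𝓝 0) (𝓝 0) := by
    have hc : Continuous fun v : ι → ℂ => Function.update v i 0 := by fun_prop
    simpa using hc.tendsto 0
  filter_upwards [hfq, h, hupd.eventually hfq] with v hv h0 hv0
  simp only [h0, Finset.sum_empty, Finset.range_one, Finset.sum_singleton, pow_one, pow_zero,
    Function.update_self, Function.update_idem] at hv hv0
  rw [hv]
  linear_combination -hv0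

theorem update_one_zero_eq (v : Fin 2 → ℂ) : Function.update v 1 0 = ![v 0, 0] := by
  ext j; fin_cases j <;> simp

/-- The map `(x, y) ↦ (x, y³, y^{3n+2} + xy)`. -/
def hMap (n : ℕ) (v : Fin 2 → ℂ) : Fin 3 → ℂ :=
  ![v 0, v 1 ^ 3, v 1 ^ (3 * n + 2) + v 0 * v 1]

/-- The defining equation of the image of `hMap n`. -/
def imageEquation (n : ℕ) (V : Fin 3 → ℂ) : ℂ :=
  V 2 ^ 3 - 3 * V 0 * V 1 ^ (n + 1) * V 2 - V 0 ^ 3 * V 1 - V 1 ^ (3 * n + 2)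

theorem imageEquation_hMap (n : ℕ) (v : Fin 2 → ℂ) : imageEquation n (hMap n v) = 0 := by
  simp only [imageEquation, hMap, Matrix.cons_val]
  ring

theorem hMap_zero (n : ℕ) : hMap n 0 = 0 := by
  ext j; fin_cases j <;> simp [hMap]

theorem tendsto_hMap (n : ℕ) : Tendsto (hMap n) (𝓝 0) (𝓝 0) := by
  have hc : Continuous (hMap n) := by
    unfold hMap
    fun_prop
  simpa [hMap_zero] using hc.tendsto 0

theorem analyticAt_hMap (n : ℕ) : AnalyticAt ℂ (hMap n) 0 := by
  refine analyticAt_pi_iff.2 fun j => ?_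
  fin_cases j <;> simp only [hMap, Fin.reduceFinMk, Fin.zero_eta, Matrix.cons_val] <;> fun_prop

theorem tendsto_firstTwo : Tendsto (fun V : Fin 3 → ℂ => ![V 0, V 1]) (𝓝 0) (𝓝 0) := by
  have hc : Continuous fun V : Fin 3 → ℂ => ![V 0, V 1] := by fun_prop
  have h0 : ![(0 : Fin 3 → ℂ) 0, (0 : Fin 3 → ℂ) 1] = 0 := by simp
  simpa only [h0] using hc.tendsto 0

theorem AnalyticAt.comp_firstTwo {A : (Fin 2 → ℂ) → ℂ} (hA : AnalyticAt ℂ A 0) :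
    AnalyticAt ℂ (fun V : Fin 3 → ℂ => A ![V 0, V 1]) 0 := by
  refine hA.comp_of_eq (analyticAt_pi_iff.2 fun j => ?_) (by simp)
  fin_cases j <;> simp <;> fun_prop

theorem AnalyticAt.comp_cube {A : (Fin 2 → ℂ) → ℂ} (hA : AnalyticAt ℂ A 0) :
    AnalyticAt ℂ (fun v : Fin 2 → ℂ => A ![v 0, v 1 ^ 3]) 0 := by
  refine hA.comp_of_eq (analyticAt_pi_iff.2 fun j => ?_) (by simp)
  fin_cases j <;> simp <;> fun_prop

theorem AnalyticAt.exists_division_imageEquation {n : ℕ} (hn : 1 ≤ n) {f : (Fin 3 → ℂ) → ℂ}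
    (hf : AnalyticAt ℂ f 0) :
    ∃ (q : (Fin 3 → ℂ) → ℂ) (A₀ A₁ A₂ : (Fin 2 → ℂ) → ℂ), AnalyticAt ℂ q 0 ∧
      AnalyticAt ℂ A₀ 0 ∧ AnalyticAt ℂ A₁ 0 ∧ AnalyticAt ℂ A₂ 0 ∧
      ∀ᶠ V in 𝓝 0, f V = q V * imageEquation n V +
        (A₀ ![V 0, V 1] + A₁ ![V 0, V 1] * V 2 + A₂ ![V 0, V 1] * V 2 ^ 2) := by
  obtain ⟨q, g, hq, hg, hfq⟩ := hf.exists_division 2 3 (Finset.univ : Finset (Fin 3))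
    ![3, 1, 1] ![![1, n + 1, 1], ![3, 1, 0], ![0, 3 * n + 2, 0]] (by
      intro j _
      fin_cases j <;> simp [Fin.sum_univ_three] <;> omega)
  have hA : ∀ l, AnalyticAt ℂ (fun u : Fin 2 → ℂ => g l ![u 0, u 1, 0]) 0 := fun l => by
    refine (hg l).comp_of_eq (analyticAt_pi_iff.2 fun j => ?_) (by simp)
    fin_cases j <;> simp <;> fun_prop
  refine ⟨q, _, _, _, hq, hA 0, hA 1, hA 2, ?_⟩
  filter_upwards [hfq] with V hV
  have hupd : Function.update V 2 0 = ![V 0, V 1, 0] := by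
    ext j; fin_cases j <;> simp
  simp [Finset.sum_range_succ, Fin.sum_univ_three, monomialValue, Fin.prod_univ_three, hupd] at hV
  rw [hV, imageEquation]
  simp only [Matrix.cons_val_zero, Matrix.cons_val_one]
  ring

theorem eventually_eq_zero_of_cube_sum_eq_zero {A₀ A₁ A₂ : (Fin 2 → ℂ) → ℂ}
    (h₀ : AnalyticAt ℂ A₀ 0) (h₁ : AnalyticAt ℂ A₁ 0) (h₂ : AnalyticAt ℂ A₂ 0)
    (h : ∀ᶠ v in 𝓝 (0 : Fin 2 → ℂ), A₀ ![v 0, v 1 ^ 3] + v 1 * A₁ ![v 0, v 1 ^ 3] +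
      v 1 ^ 2 * A₂ ![v 0, v 1 ^ 3] = 0) :
    ∀ᶠ u in 𝓝 0, A₀ u = 0 ∧ A₁ u = 0 ∧ A₂ u = 0 := by
  obtain ⟨ω, hω⟩ : ∃ ω : ℂ, ω ^ 2 + ω + 1 = 0 := by
    have hω := (Complex.isPrimitiveRoot_exp 3 (by norm_num)).geom_sum_eq_zero (by norm_num)
    refine ⟨Complex.exp (2 * Real.pi * Complex.I / (3 : ℕ)), ?_⟩
    simp only [Finset.sum_range_succ, Finset.sum_range_zero] at hω
    linear_combination hω
  have hω3 : ω ^ 3 = 1 := by linear_combination (ω - 1) * hω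
  have hωn : ‖ω‖ = 1 := by
    have := congrArg norm hω3
    rw [norm_pow, norm_one] at this
    exact (pow_eq_one_iff_of_nonneg (norm_nonneg _) (by norm_num)).1 this
  have key : ∀ᶠ u in 𝓝 (0 : Fin 2 → ℂ), u 1 ≠ 0 → A₀ u = 0 ∧ A₁ u = 0 ∧ A₂ u = 0 := by
    obtain ⟨ε, hε, hball⟩ := Metric.eventually_nhds_iff_ball.1 h
    filter_upwards [Metric.ball_mem_nhds (0 : Fin 2 → ℂ) (lt_min hε (pow_pos hε 3))] with u hu hu1
    obtain ⟨y, hy⟩ := IsAlgClosed.exists_pow_nat_eq (u 1) (n := 3) (by norm_num)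
    rw [mem_ball_zero_iff, lt_min_iff] at hu
    have hyε : ‖y‖ < ε := by
      refine lt_of_pow_lt_pow_left₀ 3 hε.le ?_
      rw [← norm_pow, hy]
      exact (norm_le_pi_norm u 1).trans_lt hu.2
    have hrot : ∀ z : ℂ, ‖z‖ = 1 → z ^ 3 = 1 →
        A₀ u + (z * y) * A₁ u + (z * y) ^ 2 * A₂ u = 0 := fun z hz hz3 => by
      have hv := hball ![u 0, z * y] (by
        rw [mem_ball_zero_iff, pi_norm_lt_iff hε]
        intro j
        fin_cases j
        · simpa using (norm_le_pi_norm u 0).trans_lt hu.1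
        · simpa [hz] using hyε)
      have huv : ![u 0, (z * y) ^ 3] = u := by
        rw [mul_pow, hz3, hy, one_mul]
        ext j; fin_cases j <;> simp
      simpa [huv] using hv
    have e₁ := hrot 1 (by simp) (by simp)
    have e₂ := hrot ω hωn hω3
    have e₃ := hrot (ω ^ 2) (by simp [hωn]) (by rw [← pow_mul, mul_comm, pow_mul, hω3, one_pow])
    have hy0 : y ≠ 0 := by
      rintro rfl
      exact hu1 (by simp [← hy])
    refine ⟨?_, ?_, ?_⟩
    · have : 3 * A₀ u = 0 := by
        linear_combination e₁ + e₂ + e₃ - (y * A₁ u + y ^ 2 * A₂ u) * hω -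
          y ^ 2 * A₂ u * ω * hω3
      simpa using this
    · have : 3 * y * A₁ u = 0 := by
        linear_combination e₁ + ω ^ 2 * e₂ + ω * e₃ - (A₀ u + y ^ 2 * A₂ u) * hω -
          (2 * y * A₁ u + y ^ 2 * A₂ u * (ω + ω ^ 2)) * hω3
      simpa [hy0] using this
    · have : 3 * y ^ 2 * A₂ u = 0 := by
        linear_combination e₁ + ω * e₂ + ω ^ 2 * e₃ - (A₀ u + y * A₁ u) * hω -
          (y * A₁ u * ω + y ^ 2 * A₂ u * (2 + ω ^ 3)) * hω3
      simpa [hy0] using this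
  filter_upwards [h₀.eventually_eq_zero_of_coord_ne 1 (key.mono fun u hu hu1 => (hu hu1).1),
    h₁.eventually_eq_zero_of_coord_ne 1 (key.mono fun u hu hu1 => (hu hu1).2.1),
    h₂.eventually_eq_zero_of_coord_ne 1 (key.mono fun u hu hu1 => (hu hu1).2.2)] with u a b c
  exact ⟨a, b, c⟩

theorem exists_coeffs_of_sq_dvd_pullback {n : ℕ} (hn : 1 ≤ n) {b : (Fin 3 → ℂ) → ℂ}
    (hb : AnalyticAt ℂ b 0) {s : (Fin 2 → ℂ) → ℂ} (hs : AnalyticAt ℂ s 0)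
    (h : ∀ᶠ v in 𝓝 0, b (hMap n v) = 3 * v 1 ^ 2 * s v) :
    ∃ B₁ B₂ : (Fin 3 → ℂ) → ℂ, AnalyticAt ℂ B₁ 0 ∧ AnalyticAt ℂ B₂ 0 ∧
      ∀ᶠ V in 𝓝 0, b V = V 1 * B₁ V + V 2 ^ 2 * B₂ V := by
  obtain ⟨q, A₀, A₁, A₂, hq, hA₀, hA₁, hA₂, hdiv⟩ := hb.exists_division_imageEquation hn
  have hpull : ∀ᶠ v in 𝓝 (0 : Fin 2 → ℂ), A₀ ![v 0, v 1 ^ 3] +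
      A₁ ![v 0, v 1 ^ 3] * (v 1 ^ (3 * n + 2) + v 0 * v 1) +
      A₂ ![v 0, v 1 ^ 3] * (v 1 ^ (3 * n + 2) + v 0 * v 1) ^ 2 = 3 * v 1 ^ 2 * s v := by
    filter_upwards [h, (tendsto_hMap n).eventually hdiv] with v hv hv'
    rw [hv, imageEquation_hMap] at hv'
    simp only [hMap, Matrix.cons_val] at hv'
    linear_combination -hv'
  have hres : Tendsto (fun v : Fin 2 → ℂ => Function.update v 1 0) (𝓝 0) (𝓝 0) := by
    have hc : Continuous fun v : Fin 2 → ℂ => Function.update v 1 0 := by fun_prop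
    simpa using hc.tendsto 0
  have hA₀z : ∀ᶠ v in 𝓝 0, A₀ (Function.update v 1 0) = 0 := by
    filter_upwards [hres.eventually hpull] with v hv
    rw [update_one_zero_eq] at hv ⊢
    simpa using hv
  obtain ⟨β₀, hβ₀, hA₀β⟩ := hA₀.exists_eq_coord_mul 1 hA₀z
  have hcube : Tendsto (fun v : Fin 2 → ℂ => ![v 0, v 1 ^ 3]) (𝓝 0) (𝓝 0) := by
    have hc : Continuous fun v : Fin 2 → ℂ => ![v 0, v 1 ^ 3] := by fun_prop
    have h0 : ![(0 : Fin 2 → ℂ) 0, (0 : Fin 2 → ℂ) 1 ^ 3] = 0 := by simp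
    simpa only [h0] using hc.tendsto 0
  have hquot : ∀ᶠ v in 𝓝 (0 : Fin 2 → ℂ), v 1 ^ 2 * β₀ ![v 0, v 1 ^ 3] +
      A₁ ![v 0, v 1 ^ 3] * (v 1 ^ (3 * n + 1) + v 0) +
      A₂ ![v 0, v 1 ^ 3] * (v 1 * (v 1 ^ (3 * n + 1) + v 0) ^ 2) - 3 * v 1 * s v = 0 := by
    have hβ' := hβ₀.comp_cube
    have hA₁' := hA₁.comp_cube
    have hA₂' := hA₂.comp_cube
    have hsum := (((AnalyticAt.fun_mul (f := fun v : Fin 2 → ℂ => v 1 ^ 2) (by fun_prop)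
      hβ').fun_add (hA₁'.fun_mul (g := fun v => v 1 ^ (3 * n + 1) + v 0) (by fun_prop))).fun_add
      (hA₂'.fun_mul (g := fun v => v 1 * (v 1 ^ (3 * n + 1) + v 0) ^ 2) (by fun_prop))).fun_sub
      (AnalyticAt.fun_mul (f := fun v : Fin 2 → ℂ => 3 * v 1) (by fun_prop) hs)
    refine hsum.eventually_eq_zero_of_coord_ne 1 ?_
    filter_upwards [hpull, hcube.eventually hA₀β] with v hv hv' hv1
    simp only [Matrix.cons_val] at hv'
    rw [hv'] at hv
    refine mul_left_cancel₀ hv1 ?_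
    linear_combination hv
  have hA₁z : ∀ᶠ v in 𝓝 0, A₁ (Function.update v 1 0) = 0 := by
    have hA₁' : AnalyticAt ℂ (fun v : Fin 2 → ℂ => A₁ (Function.update v 1 0)) 0 := by
      refine hA₁.comp_of_eq (analyticAt_pi_iff.2 fun j => ?_) (by simp)
      fin_cases j <;> simp <;> fun_prop
    refine hA₁'.eventually_eq_zero_of_coord_ne 0 ?_
    filter_upwards [hres.eventually hquot] with v hv hv0
    rw [update_one_zero_eq] at hv ⊢
    simpa [hv0] using hv
  obtain ⟨β₁, hβ₁, hA₁β⟩ := hA₁.exists_eq_coord_mul 1 hA₁z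
  have hβ₀' := hβ₀.comp_firstTwo
  have hβ₁' := hβ₁.comp_firstTwo
  have hA₂' := hA₂.comp_firstTwo
  refine ⟨fun V => β₀ ![V 0, V 1] + β₁ ![V 0, V 1] * V 2 -
      q V * (3 * V 0 * V 1 ^ n * V 2 + V 0 ^ 3 + V 1 ^ (3 * n + 1)),
    fun V => q V * V 2 + A₂ ![V 0, V 1],
    (hβ₀'.fun_add (hβ₁'.fun_mul (analyticAt_coord 2 0))).fun_sub (by fun_prop),
    (hq.fun_mul (analyticAt_coord 2 0)).fun_add hA₂', ?_⟩
  filter_upwards [hdiv, tendsto_firstTwo.eventually hA₀β, tendsto_firstTwo.eventually hA₁β]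
    with V hV h0 h1
  simp only [Matrix.cons_val] at h0 h1
  rw [hV, h0, h1, imageEquation]
  ring

theorem exists_coeffs_of_horizontal_lift {n : ℕ} (hn : 1 ≤ n) {a c : (Fin 3 → ℂ) → ℂ}
    (ha : AnalyticAt ℂ a 0) (hc : AnalyticAt ℂ c 0)
    (h : ∀ᶠ v in 𝓝 0, v 1 * a (hMap n v) = c (hMap n v)) :
    ∃ t₂ t₃ t₄ : (Fin 3 → ℂ) → ℂ, AnalyticAt ℂ t₂ 0 ∧ AnalyticAt ℂ t₃ 0 ∧ AnalyticAt ℂ t₄ 0 ∧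
      ∀ᶠ V in 𝓝 0,
        a V = t₂ V * (V 0 ^ 2 + V 1 ^ n * V 2) + t₃ V * (V 2 ^ 2 - V 0 * V 1 ^ (n + 1)) +
          t₄ V * (V 0 * V 2 + V 1 ^ (2 * n + 1)) ∧
        c V = t₂ V * (V 0 * V 2 + V 1 ^ (2 * n + 1)) +
          t₃ V * (V 0 ^ 2 * V 1 + V 1 ^ (n + 1) * V 2) +
          t₄ V * (V 2 ^ 2 - V 0 * V 1 ^ (n + 1)) := by
  obtain ⟨q, a₀, a₁, a₂, hq, ha₀, ha₁, ha₂, hadiv⟩ := ha.exists_division_imageEquation hn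
  obtain ⟨q', c₀, c₁, c₂, hq', hc₀, hc₁, hc₂, hcdiv⟩ := hc.exists_division_imageEquation hn
  have hrel : ∀ᶠ u in 𝓝 (0 : Fin 2 → ℂ),
      u 1 ^ (n + 1) * a₁ u + u 0 ^ 2 * u 1 * a₂ u - c₀ u - 2 * u 0 * u 1 ^ (n + 1) * c₂ u = 0 ∧
      a₀ u + 2 * u 0 * u 1 ^ (n + 1) * a₂ u - u 0 * c₁ u - u 1 ^ (2 * n + 1) * c₂ u = 0 ∧
      u 0 * a₁ u + u 1 ^ (2 * n + 1) * a₂ u - u 1 ^ n * c₁ u - u 0 ^ 2 * c₂ u = 0 := by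
    refine eventually_eq_zero_of_cube_sum_eq_zero (by fun_prop) (by fun_prop) (by fun_prop) ?_
    filter_upwards [h, (tendsto_hMap n).eventually hadiv, (tendsto_hMap n).eventually hcdiv]
      with v hv hav hcv
    rw [hav, hcv, imageEquation_hMap] at hv
    simp only [hMap, Matrix.cons_val] at hv ⊢
    linear_combination hv
  have hres : Tendsto (fun u : Fin 2 → ℂ => Function.update u 0 0) (𝓝 0) (𝓝 0) := by
    have hc : Continuous fun u : Fin 2 → ℂ => Function.update u 0 0 := by fun_prop
    simpa using hc.tendsto 0
  have hresAn : AnalyticAt ℂ (fun u : Fin 2 → ℂ => Function.update u 0 0) 0 := by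
    refine analyticAt_pi_iff.2 fun j => ?_
    fin_cases j <;> simp <;> fun_prop
  have hP : AnalyticAt ℂ (fun u : Fin 2 → ℂ => c₁ u - u 1 ^ (n + 1) * a₂ u) 0 := by fun_prop
  have hPz : ∀ᶠ u in 𝓝 (0 : Fin 2 → ℂ), c₁ (Function.update u 0 0) -
      Function.update u 0 0 1 ^ (n + 1) * a₂ (Function.update u 0 0) = 0 := by
    refine AnalyticAt.eventually_eq_zero_of_coord_ne (hP.comp_of_eq hresAn (by simp)) 1 ?_
    filter_upwards [hres.eventually hrel] with u hu hu1
    refine mul_left_cancel₀ (pow_ne_zero n hu1) ?_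
    have hu3 := hu.2.2
    simp only [Function.update_self, Function.update_of_ne one_ne_zero] at hu3 ⊢
    linear_combination -hu3
  obtain ⟨d, hd, hPd⟩ := hP.exists_eq_coord_mul 0 hPz
  have ha₁d : ∀ᶠ u in 𝓝 (0 : Fin 2 → ℂ), a₁ u - u 0 * c₂ u - u 1 ^ n * d u = 0 := by
    refine AnalyticAt.eventually_eq_zero_of_coord_ne (by fun_prop) 0 ?_
    filter_upwards [hrel, hPd] with u hu hud hu0
    refine mul_left_cancel₀ hu0 ?_
    linear_combination hu.2.2 + u 1 ^ n * hud
  have hd' := hd.comp_firstTwo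
  have ha₂' := ha₂.comp_firstTwo
  have hc₂' := hc₂.comp_firstTwo
  refine ⟨fun V => d ![V 0, V 1] - q V * (V 0 * V 1) - q' V * V 1 ^ (n + 1),
    fun V => a₂ ![V 0, V 1] + q V * V 2 - q' V * V 0,
    fun V => c₂ ![V 0, V 1] - q V * V 1 ^ (n + 1) + q' V * V 2,
    (hd'.fun_sub (by fun_prop)).fun_sub (by fun_prop),
    (ha₂'.fun_add (by fun_prop)).fun_sub (by fun_prop),
    (hc₂'.fun_sub (by fun_prop)).fun_add (by fun_prop), ?_⟩
  filter_upwards [hadiv, hcdiv, tendsto_firstTwo.eventually hrel, tendsto_firstTwo.eventually hPd,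
    tendsto_firstTwo.eventually ha₁d] with V haV hcV hr hPV h1V
  simp only [Matrix.cons_val] at hr hPV h1V
  obtain ⟨hr₀, hr₁, hr₂⟩ := hr
  have e₁ : a₁ ![V 0, V 1] = V 0 * c₂ ![V 0, V 1] + V 1 ^ n * d ![V 0, V 1] := by
    linear_combination h1V
  have e₂ : c₁ ![V 0, V 1] = V 1 ^ (n + 1) * a₂ ![V 0, V 1] + V 0 * d ![V 0, V 1] := by
    linear_combination hPV
  rw [e₁] at hr₀
  rw [e₂] at hr₁
  constructor
  · rw [haV, e₁, imageEquation]
    linear_combination hr₁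
  · rw [hcV, e₂, imageEquation]
    linear_combination -hr₀

theorem fderiv_hMap_apply (n : ℕ) (v w : Fin 2 → ℂ) :
    fderiv ℂ (hMap n) v w = ![w 0, 3 * v 1 ^ 2 * w 1,
      v 1 * w 0 + ((3 * n + 2 : ℂ) * v 1 ^ (3 * n + 1) + v 0) * w 1] := by
  have hp : ∀ i : Fin 2, HasFDerivAt (fun v : Fin 2 → ℂ => v i)
      (ContinuousLinearMap.proj (R := ℂ) (φ := fun _ : Fin 2 => ℂ) i) v := fun i =>
    (ContinuousLinearMap.proj (R := ℂ) (φ := fun _ : Fin 2 => ℂ) i).hasFDerivAt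
  have hd : DifferentiableAt ℂ (hMap n) v := by
    refine differentiableAt_pi.2 fun j => ?_
    fin_cases j <;> simp only [hMap, Fin.reduceFinMk, Fin.zero_eta, Matrix.cons_val] <;> fun_prop
  have hcoord : ∀ j, fderiv ℂ (hMap n) v w j = fderiv ℂ (fun v => hMap n v j) v w := fun j => by
    rw [fderiv_apply hd]
    rfl
  ext j
  rw [hcoord]
  fin_cases j
  · simp only [hMap, Fin.zero_eta, Matrix.cons_val]
    rw [(hp 0).fderiv]
    simp
  · simp only [hMap, Fin.mk_one, Matrix.cons_val]
    rw [((hp 1).pow 3).fderiv]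
    simp
  · simp only [hMap, Fin.reduceFinMk, Matrix.cons_val]
    rw [(((hp 1).pow (3 * n + 2)).fun_add ((hp 0).fun_mul (hp 1))).fderiv]
    simp
    ring

/-- for `k ≥ 2`, every vector-field germ liftable over
`H_k(x,y) = (x, y³, y^{3k−1}+xy)` is an `𝒪₃`-combination of ζ₁,…,ζ₅;
i.e. these five vector fields generate the module `Lift(H_k)`. -/
theorem liftable_fields_of_Hk_generated
    (k : ℕ) (hk : 2 ≤ k)
    (H : (Fin 2 → ℂ) → (Fin 3 → ℂ))
    (hH : ∀ v : Fin 2 → ℂ, H v = ![v 0, (v 1) ^ 3, (v 1) ^ (3 * k - 1) + v 0 * v 1])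
    (η : (Fin 3 → ℂ) → (Fin 3 → ℂ)) (hη : AnalyticAt ℂ η 0)
    (hlift : Liftable H η) :
    ∃ α : Fin 5 → ((Fin 3 → ℂ) → ℂ),
      (∀ i, AnalyticAt ℂ (α i) 0) ∧
      ∀ᶠ V in 𝓝 (0 : Fin 3 → ℂ), η V = ∑ i : Fin 5, α i V • zeta k i V := by
  obtain ⟨n, rfl⟩ : ∃ n, k = n + 1 := ⟨k - 1, by omega⟩
  have hn : 1 ≤ n := by omega
  have k₁ : 3 * (n + 1) - 1 = 3 * n + 2 := by omega
  have k₂ : 3 * (n + 1) - 2 = 3 * n + 1 := by omega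
  have k₃ : 2 * (n + 1) - 1 = 2 * n + 1 := by omega
  have k₄ : 2 * (n + 1) - 2 = 2 * n := by omega
  obtain rfl : H = hMap n := funext fun v => by rw [hH, k₁, hMap]
  obtain ⟨ξ, hξ, hlift⟩ := hlift
  have hηj : ∀ j, AnalyticAt ℂ (fun V => η V j) 0 := analyticAt_pi_iff.1 hη
  have hξ₁ : AnalyticAt ℂ (fun v => ξ v 1) 0 := analyticAt_pi_iff.1 hξ 1
  have hlift' : ∀ᶠ v in 𝓝 (0 : Fin 2 → ℂ), η (hMap n v) 1 = 3 * v 1 ^ 2 * ξ v 1 ∧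
      η (hMap n v) 2 = v 1 * η (hMap n v) 0 +
        ((3 * n + 2 : ℂ) * v 1 ^ (3 * n + 1) + v 0) * ξ v 1 := by
    filter_upwards [hlift] with v hv
    rw [← hv, fderiv_hMap_apply]
    simp
  obtain ⟨B₁, B₂, hB₁, hB₂, hB⟩ :=
    exists_coeffs_of_sq_dvd_pullback hn (hηj 1) hξ₁ (hlift'.mono fun v hv => hv.1)
  let a : (Fin 3 → ℂ) → ℂ := fun V => η V 0 - B₁ V / 3 * ((3 * n + 1) * V 0) -
    B₂ V / 3 * (-(3 * n + 2) * V 1 ^ (2 * n) * V 2 - V 0 ^ 2 * V 1 ^ n)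
  let c : (Fin 3 → ℂ) → ℂ := fun V => η V 2 - B₁ V / 3 * ((3 * n + 2) * V 2) -
    B₂ V / 3 * ((3 * n + 3) * V 0 * V 1 ^ n * V 2 + V 0 ^ 3)
  have hη₀ := hηj 0
  have hη₂ := hηj 2
  have ha : AnalyticAt ℂ a 0 := by fun_prop
  have hc : AnalyticAt ℂ c 0 := by fun_prop
  have hac : ∀ᶠ v in 𝓝 0, v 1 * a (hMap n v) - c (hMap n v) = 0 := by
    have ha' : AnalyticAt ℂ (fun v => a (hMap n v)) 0 :=
      ha.comp_of_eq (analyticAt_hMap n) (hMap_zero n)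
    have hc' : AnalyticAt ℂ (fun v => c (hMap n v)) 0 :=
      hc.comp_of_eq (analyticAt_hMap n) (hMap_zero n)
    refine (((analyticAt_coord 1 0).fun_mul ha').fun_sub hc').eventually_eq_zero_of_coord_ne 1 ?_
    filter_upwards [hlift', (tendsto_hMap n).eventually hB] with v hv hBv hv1
    obtain ⟨hv₁, hv₂⟩ := hv
    rw [hv₁] at hBv
    have hs : ξ v 1 =
        (v 1 * B₁ (hMap n v) + (v 1 ^ (3 * n + 1) + v 0) ^ 2 * B₂ (hMap n v)) / 3 := by
      refine mul_left_cancel₀ (pow_ne_zero 2 hv1) ?_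
      have h1 : hMap n v 1 = v 1 ^ 3 := rfl
      have h2 : hMap n v 2 = v 1 ^ (3 * n + 2) + v 0 * v 1 := rfl
      rw [h1, h2] at hBv
      linear_combination hBv / 3
    rw [hs] at hv₂
    simp only [a, c]
    rw [hv₂]
    have h0 : hMap n v 0 = v 0 := rfl
    have h1 : hMap n v 1 = v 1 ^ 3 := rfl
    have h2 : hMap n v 2 = v 1 ^ (3 * n + 2) + v 0 * v 1 := rfl
    rw [h0, h1, h2]
    ring
  obtain ⟨t₂, t₃, t₄, ht₂, ht₃, ht₄, ht⟩ :=
    exists_coeffs_of_horizontal_lift hn ha hc (hac.mono fun v hv => sub_eq_zero.1 hv)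
  have hp : (3 * n + 2 : ℂ) ≠ 0 := by exact_mod_cast (by omega : 3 * n + 2 ≠ 0)
  refine ⟨![fun V => B₁ V / 3 + (V 0 * t₂ V + V 2 * t₄ V) / (3 * n + 2),
    fun V => t₂ V / (3 * n + 2), t₃, fun V => t₄ V / (3 * n + 2), fun V => B₂ V / 3], ?_, ?_⟩
  · intro i
    fin_cases i <;> simp <;> fun_prop (disch := assumption)
  · filter_upwards [hB, ht] with V hBV htV
    obtain ⟨haV, hcV⟩ := htV
    simp only [a, c] at haV hcV
    ext j
    simp only [zeta, k₁, k₂, k₃, k₄, Fin.sum_univ_five, Matrix.cons_val, Pi.add_apply,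
      Pi.smul_apply, smul_eq_mul, add_tsub_cancel_right]
    push_cast
    fin_cases j <;> simp only [Fin.reduceFinMk, Fin.zero_eta, Fin.mk_one, Matrix.cons_val]
    · field_simp
      linear_combination 3 * (3 * n + 2) * haV
    · field_simp
      linear_combination (3 * n + 2) * hBV
    · field_simp
      linear_combination 3 * hcV
end
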